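/- Suppose x ∈ (0,1) is such that for every k and every string s of k positive integers, the disjoint block frequency lim_{n→∞} |{i : 0 ≤ i ≤ n/k, T^{ki}x ∈ C_s}| / (n/k) equals γ(C_s). Let s' be a string of length k, let p, q be positive integers, and let D₁, D₂, … enumerate all strings of length p+q+k in which s' occurs starting at position p+1. Then lim_{n→∞} Σ_{j=1}^∞ |{i : 0 ≤ i ≤ n/(p+q+k), T^{(p+q+k)i}x ∈ C_{D_j}}| / (n/(p+q+k)) = γ(C_{s'}). -/

import Mathlib

open MeasureTheory Filter

noncomputable def gaussMap (x : ℝ) : ℝ := Int.fract x⁻¹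

noncomputable def gaussMeasure : Measure ℝ :=
  (volume.restrict (Set.Ioo (0:ℝ) 1)).withDensity
    (fun x => ENNReal.ofReal (1 / ((1 + x) * Real.log 2)))

noncomputable def cfDigit (x : ℝ) (i : ℕ) : ℕ := ⌊(gaussMap^[i] x)⁻¹⌋₊

def cylinder (w : List ℕ) : Set ℝ :=
  {x | x ∈ Set.Ioo (0:ℝ) 1 ∧ ∀ i < w.length, cfDigit x i = w.getD i 0}

noncomputable def blockCount (x : ℝ) (m : ℕ) (s : List ℕ) (N : ℕ) : ℕ :=
  Nat.card {i : ℕ // i ≤ N ∧ (gaussMap^[m * i] x) ∈ cylinder s}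

def CFNormal (x : ℝ) : Prop :=
  ∀ s : List ℕ, s ≠ [] → (∀ a ∈ s, 0 < a) →
    Tendsto (fun n : ℕ => (blockCount x 1 s n : ℝ) / n) atTop
      (nhds (gaussMeasure (cylinder s)).toReal)

def cfVal : List ℕ → ℚ
  | [] => 0
  | a :: t => 1 / (a + cfVal t)

def cfQ (a : ℕ → ℕ) : ℕ → ℕ
  | 0 => 0
  | 1 => 1
  | (m+2) => a (m+1) * cfQ a (m+1) + cfQ a m

def cfP (a : ℕ → ℕ) : ℕ → ℕ
  | 0 => 1
  | 1 => 0
  | (m+2) => a (m+1) * cfP a (m+1) + cfP a m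

lemma tendsto_tsum_subtype_of_mass_le {α : Type*} (A : α → Prop) (f : ℕ → α → ℝ) (g : α → ℝ)
    (c : ℕ → ℝ) (hf : ∀ n i, 0 ≤ f n i) (hc : ∀ n (F : Finset α), ∑ i ∈ F, f n i ≤ c n)
    {M : ℝ} (hcM : Tendsto c atTop (nhds M))
    (hfg : ∀ i, Tendsto (fun n => f n i) atTop (nhds (g i))) (hg : HasSum g M) :
    Tendsto (fun n => ∑' i : {i // A i}, f n i) atTop (nhds (∑' i : {i // A i}, g i)) := by
  classical
  have hg0 : ∀ i, 0 ≤ g i := fun i => ge_of_tendsto' (hfg i) fun n => hf n i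
  have hfs : ∀ n, Summable (f n) := fun n => summable_of_sum_le (hf n) (hc n)
  have key : ∀ h : α → ℝ, (∀ i, 0 ≤ h i) → Summable h → ∀ F : Finset α,
      ∑ i ∈ F with A i, h i ≤ ∑' i : {i // A i}, h i ∧
      ∑' i : {i // A i}, h i ≤ ∑ i ∈ F with A i, h i + (∑' i, h i - ∑ i ∈ F, h i) := by
    intro h h0 hs F
    have e : ∀ P : α → Prop, ∑' i : {i // P i}, h i = ∑' i, Set.indicator {i | P i} h i :=
      fun P => tsum_subtype {i | P i} h
    have hsum : ∀ P : α → Prop, Summable (Set.indicator {i | P i} h) :=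
      fun P => hs.indicator _
    have ind0 : ∀ (P : α → Prop) i, 0 ≤ Set.indicator {i | P i} h i :=
      fun P i => Set.indicator_nonneg (fun i _ => h0 i) i
    have eF : ∀ P : α → Prop, ∑ i ∈ F with P i, h i = ∑ i ∈ F, Set.indicator {i | P i} h i := by
      intro P
      rw [Finset.sum_filter]
      refine Finset.sum_congr rfl fun i _ => ?_
      simp [Set.indicator_apply]
    have low : ∀ P : α → Prop, ∑ i ∈ F with P i, h i ≤ ∑' i : {i // P i}, h i := by
      intro P
      rw [e, eF]
      exact (hsum P).sum_le_tsum F fun i _ => ind0 P i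
    refine ⟨low A, ?_⟩
    have h1 : ∑ i ∈ F with ¬ A i, h i ≤ ∑' i : {i // ¬ A i}, h i := by
      convert low fun i => ¬ A i
    have h2 : ∑' i : {i // A i}, h i + ∑' i : {i // ¬ A i}, h i = ∑' i, h i := by
      rw [e, e, ← (hsum A).tsum_add (hsum _)]
      refine tsum_congr fun i => ?_
      by_cases hi : A i <;> simp [hi]
    have h3 := Finset.sum_filter_add_sum_filter_not F A h
    linarith
  rw [Metric.tendsto_atTop']
  intro ε hε
  obtain ⟨F, hF⟩ := (hg.eventually (lt_mem_nhds (show M - ε / 8 < M by linarith))).exists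
  have t1 : Tendsto (fun n => ∑ i ∈ F with A i, f n i) atTop
      (nhds (∑ i ∈ F with A i, g i)) := tendsto_finsetSum _ fun i _ => hfg i
  have t2 : Tendsto (fun n => ∑ i ∈ F, f n i) atTop (nhds (∑ i ∈ F, g i)) :=
    tendsto_finsetSum _ fun i _ => hfg i
  have ev := (((Metric.tendsto_nhds.1 t1 (ε / 8) (by positivity)).and
    (Metric.tendsto_nhds.1 t2 (ε / 8) (by positivity))).and
    (Metric.tendsto_nhds.1 hcM (ε / 8) (by positivity)))
  obtain ⟨N, hN⟩ := eventually_atTop.1 ev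
  refine ⟨N, fun n hn => ?_⟩
  obtain ⟨⟨a1, a2⟩, a3⟩ := hN n hn.le
  rw [Real.dist_eq, abs_lt] at *
  obtain ⟨b1, b2⟩ := key (f n) (hf n) (hfs n) F
  obtain ⟨d1, d2⟩ := key g hg0 hg.summable F
  have hle : ∑' i, f n i ≤ c n := (hfs n).tsum_le_of_sum_le (hc n)
  have hge := hg.tsum_eq
  constructor <;> linarith [a1.1, a1.2, a2.1, a2.2, a3.1, a3.2]

lemma measurable_gaussMap : Measurable gaussMap :=
  measurable_fract.comp measurable_inv

lemma measurable_cfDigit (i : ℕ) : Measurable fun x => cfDigit x i :=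
  Nat.measurable_floor.comp ((measurable_gaussMap.iterate i).inv)

lemma measurableSet_cylinder (w : List ℕ) : MeasurableSet (cylinder w) := by
  have : cylinder w = Set.Ioo (0 : ℝ) 1 ∩ ⋂ i, ⋂ (_ : i < w.length),
      (fun x => cfDigit x i) ⁻¹' {w.getD i 0} := by
    ext x; simp [_root_.cylinder]
  rw [this]
  exact measurableSet_Ioo.inter <| MeasurableSet.iInter fun i => MeasurableSet.iInter fun _ =>
    measurable_cfDigit i (measurableSet_singleton _)

lemma cfDigit_iterate (x : ℝ) (p i : ℕ) : cfDigit (gaussMap^[p] x) i = cfDigit x (p + i) := by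
  rw [cfDigit, cfDigit, ← Function.iterate_add_apply, add_comm]

lemma gaussMap_mem {x : ℝ} (h : Irrational x) : Irrational (gaussMap x) ∧
    gaussMap x ∈ Set.Ioo (0 : ℝ) 1 := by
  have h1 : Irrational (gaussMap x) := by
    have := h.inv.sub_intCast ⌊x⁻¹⌋
    rwa [Int.self_sub_floor] at this
  exact ⟨h1, lt_of_le_of_ne (Int.fract_nonneg _) h1.ne_zero.symm, Int.fract_lt_one _⟩

lemma iterate_gaussMap_mem {x : ℝ} (hx : Irrational x) (h : x ∈ Set.Ioo (0 : ℝ) 1) (n : ℕ) :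
    Irrational (gaussMap^[n] x) ∧ gaussMap^[n] x ∈ Set.Ioo (0 : ℝ) 1 := by
  induction n with
  | zero => exact ⟨hx, h⟩
  | succ n ih =>
    rw [Function.iterate_succ_apply']
    exact gaussMap_mem ih.1

lemma cfDigit_pos {x : ℝ} (hx : Irrational x) (h : x ∈ Set.Ioo (0 : ℝ) 1) (n : ℕ) :
    0 < cfDigit x n := by
  obtain ⟨-, h0, h1⟩ := iterate_gaussMap_mem hx h n
  exact Nat.floor_pos.2 ((one_le_inv₀ h0).2 h1.le)

lemma eq_of_mem_cylinder {x : ℝ} {v w : List ℕ} (hl : v.length = w.length)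
    (hv : x ∈ cylinder v) (hw : x ∈ cylinder w) : v = w := by
  refine List.ext_getElem hl fun i h1 h2 => ?_
  have a := hv.2 i h1
  have b := hw.2 i h2
  rw [List.getD_eq_getElem _ _ h1] at a
  rw [List.getD_eq_getElem _ _ h2] at b
  exact a.symm.trans b

lemma mem_cylinder_map_cfDigit {x : ℝ} (h : x ∈ Set.Ioo (0 : ℝ) 1) (m : ℕ) :
    x ∈ cylinder ((List.range m).map (cfDigit x)) := by
  refine ⟨h, fun i hi => ?_⟩
  rw [List.getD_eq_getElem _ _ hi]
  simp

lemma ae_gaussMeasure : ∀ᵐ x ∂gaussMeasure, Irrational x ∧ x ∈ Set.Ioo (0 : ℝ) 1 := by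
  refine (withDensity_absolutelyContinuous _ _).ae_le ?_
  have h1 : ∀ᵐ x ∂(volume : Measure ℝ), Irrational x := by
    have : (volume : Measure ℝ) (Set.range ((↑) : ℚ → ℝ)) = 0 :=
      (Set.countable_range _).measure_zero _
    exact measure_eq_zero_iff_ae_notMem.1 this
  filter_upwards [ae_restrict_of_ae h1, ae_restrict_mem measurableSet_Ioo] with x hx hx'
  exact ⟨hx, hx'⟩

lemma gaussMeasure_apply_Ioc {s : Set ℝ} (hs : MeasurableSet s) :
    gaussMeasure s = ∫⁻ x in s ∩ Set.Ioc 0 1, ENNReal.ofReal (1 / ((1 + x) * Real.log 2)) := by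
  rw [gaussMeasure, Measure.restrict_congr_set Ioo_ae_eq_Ioc, withDensity_apply _ hs,
    Measure.restrict_restrict hs]

lemma gaussMeasure_apply_Ico {s : Set ℝ} (hs : MeasurableSet s) :
    gaussMeasure s = ∫⁻ x in s ∩ Set.Ico 0 1, ENNReal.ofReal (1 / ((1 + x) * Real.log 2)) := by
  rw [gaussMeasure, Measure.restrict_congr_set Ioo_ae_eq_Ico, withDensity_apply _ hs,
    Measure.restrict_restrict hs]

instance : IsProbabilityMeasure gaussMeasure := by
  constructor
  have hl : 0 < Real.log 2 := Real.log_pos one_lt_two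
  have hd : ∀ x ∈ Set.uIcc (0 : ℝ) 1, HasDerivAt (fun x => Real.log (1 + x) / Real.log 2)
      (1 / ((1 + x) * Real.log 2)) x := by
    intro x hx
    rw [Set.uIcc_of_le zero_le_one] at hx
    have h1 : (1 + x) ≠ 0 := by linarith [hx.1]
    rw [← div_div]
    exact (((hasDerivAt_id x).const_add 1).log h1).div_const (Real.log 2)
  have hc : ContinuousOn (fun x : ℝ => 1 / ((1 + x) * Real.log 2)) (Set.uIcc 0 1) := by
    refine continuousOn_const.div (by fun_prop) fun x hx => ?_
    rw [Set.uIcc_of_le zero_le_one] at hx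
    have : 0 < 1 + x := by linarith [hx.1]
    positivity
  have hi := hc.intervalIntegrable (μ := volume)
  rw [gaussMeasure_apply_Ioc MeasurableSet.univ, Set.univ_inter, ← ofReal_integral_eq_lintegral_ofReal
    ((intervalIntegrable_iff_integrableOn_Ioc_of_le zero_le_one).1 hi),
    ← intervalIntegral.integral_of_le zero_le_one,
    intervalIntegral.integral_eq_sub_of_hasDerivAt hd hi]
  · norm_num [hl.ne']
  · filter_upwards [ae_restrict_mem measurableSet_Ioc] with x hx
    have : 0 < 1 + x := by linarith [hx.1]
    show 0 ≤ 1 / ((1 + x) * Real.log 2)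
    positivity

lemma preimage_gaussMap_inter_Ioc (s : Set ℝ) : gaussMap ⁻¹' s ∩ Set.Ioc 0 1 =
    ⋃ n : ℕ, (fun y : ℝ => ((n : ℝ) + 1 + y)⁻¹) '' (s ∩ Set.Ico 0 1) := by
  ext x
  simp only [Set.mem_inter_iff, Set.mem_preimage, Set.mem_iUnion, Set.mem_image]
  constructor
  · rintro ⟨hs, h0, h1⟩
    have hx1 : 1 ≤ x⁻¹ := (one_le_inv₀ h0).2 h1
    have hf : 1 ≤ ⌊x⁻¹⌋ := Int.le_floor.2 (by simpa using hx1)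
    refine ⟨(⌊x⁻¹⌋ - 1).toNat, gaussMap x, ⟨hs, Int.fract_nonneg _, Int.fract_lt_one _⟩, ?_⟩
    have : (((⌊x⁻¹⌋ - 1).toNat : ℕ) : ℝ) = ⌊x⁻¹⌋ - 1 := by
      have h : (((⌊x⁻¹⌋ - 1).toNat : ℕ) : ℤ) = ⌊x⁻¹⌋ - 1 := Int.toNat_of_nonneg (by omega)
      exact_mod_cast h
    rw [this, sub_add_cancel, gaussMap, Int.floor_add_fract, inv_inv]
  · rintro ⟨n, y, ⟨hs, h0, h1⟩, rfl⟩
    have hn : (0 : ℝ) ≤ n := n.cast_nonneg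
    refine ⟨?_, by positivity, inv_le_one_of_one_le₀ (by linarith)⟩
    have : gaussMap ((n : ℝ) + 1 + y)⁻¹ = y := by
      rw [gaussMap, inv_inv, Int.fract_eq_iff]
      exact ⟨h0, h1, n + 1, by push_cast; ring⟩
    rwa [this]

lemma hasSum_inv_mul_inv_succ {y : ℝ} (hy : 0 ≤ y) :
    HasSum (fun n : ℕ => (((n : ℝ) + 1 + y) * (n + 2 + y))⁻¹) (1 + y)⁻¹ := by
  rw [hasSum_iff_tendsto_nat_of_nonneg fun n => by positivity]
  have hs : ∀ N : ℕ, ∑ n ∈ Finset.range N, (((n : ℝ) + 1 + y) * (n + 2 + y))⁻¹ =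
      (1 + y)⁻¹ - ((N : ℝ) + (1 + y))⁻¹ := by
    intro N
    induction N with
    | zero => simp
    | succ N ih =>
      rw [Finset.sum_range_succ, ih]
      push_cast
      have : (0 : ℝ) ≤ N := N.cast_nonneg
      have h1 : (N : ℝ) + 1 + y ≠ 0 := by positivity
      have h2 : (N : ℝ) + 2 + y ≠ 0 := by positivity
      have h3 : (1 : ℝ) + y ≠ 0 := by positivity
      rw [show (N : ℝ) + (1 + y) = N + 1 + y by ring, show (N : ℝ) + 1 + (1 + y) = N + 2 + y by ring]
      field_simp
      ring
  simp_rw [hs]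
  have : Tendsto (fun N : ℕ => ((N : ℝ) + (1 + y))⁻¹) atTop (nhds 0) :=
    tendsto_inv_atTop_zero.comp (tendsto_atTop_add_const_right _ _ tendsto_natCast_atTop_atTop)
  simpa using this.const_sub (1 + y)⁻¹

lemma measurePreserving_gaussMap : MeasurePreserving gaussMap gaussMeasure gaussMeasure := by
  refine ⟨measurable_gaussMap, Measure.ext fun s hs => ?_⟩
  have hl : 0 < Real.log 2 := Real.log_pos one_lt_two
  rw [Measure.map_apply measurable_gaussMap hs,
    gaussMeasure_apply_Ioc (measurable_gaussMap hs), gaussMeasure_apply_Ico hs,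
    preimage_gaussMap_inter_Ioc]
  have hsm : MeasurableSet (s ∩ Set.Ico 0 1) := hs.inter measurableSet_Ico
  have hpos : ∀ (n : ℕ), ∀ y ∈ s ∩ Set.Ico (0 : ℝ) 1, 0 < (n : ℝ) + 1 + y := fun n y hy => by
    have := hy.2.1
    positivity
  have hd : ∀ (n : ℕ), ∀ y ∈ s ∩ Set.Ico (0 : ℝ) 1,
      HasDerivWithinAt (fun y : ℝ => ((n : ℝ) + 1 + y)⁻¹) (-1 / ((n : ℝ) + 1 + y) ^ 2)
        (s ∩ Set.Ico 0 1) y := fun n y hy =>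
    ((((hasDerivAt_id y).const_add ((n : ℝ) + 1)).inv (hpos n y hy).ne')).hasDerivWithinAt
  have hinj : ∀ n : ℕ, Set.InjOn (fun y : ℝ => ((n : ℝ) + 1 + y)⁻¹) (s ∩ Set.Ico 0 1) :=
    fun n a _ b _ hab => by simpa using hab
  rw [lintegral_iUnion]
  · simp_rw [fun n => lintegral_image_eq_lintegral_abs_deriv_mul hsm (hd n) (hinj n)]
    rw [← lintegral_tsum]
    · refine setLIntegral_congr_fun hsm fun y hy => ?_
      have hy0 := hy.2.1
      have e : ∀ n : ℕ, ENNReal.ofReal |-1 / ((n : ℝ) + 1 + y) ^ 2| *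
          ENNReal.ofReal (1 / ((1 + ((n : ℝ) + 1 + y)⁻¹) * Real.log 2)) =
          ENNReal.ofReal ((((n : ℝ) + 1 + y) * (n + 2 + y))⁻¹ * (Real.log 2)⁻¹) := by
        intro n
        have h1 := hpos n y hy
        rw [← ENNReal.ofReal_mul (abs_nonneg _), abs_div, abs_neg, abs_one,
          abs_of_pos (pow_pos h1 2)]
        congr 1
        have h2 : (n : ℝ) + 2 + y ≠ 0 := by positivity
        have h3 : 1 + ((n : ℝ) + 1 + y)⁻¹ = (n + 2 + y) / (n + 1 + y) := by
          field_simp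
          ring
        rw [h3]
        field_simp
      have hS := (hasSum_inv_mul_inv_succ hy0).mul_right (Real.log 2)⁻¹
      simp only [e]
      rw [← ENNReal.ofReal_tsum_of_nonneg (fun n => by positivity) hS.summable, hS.tsum_eq,
        one_div, mul_inv]
    · intro n
      fun_prop
  · intro n
    exact hsm.image_of_continuousOn_injOn (fun y hy => (hd n y hy).continuousWithinAt) (hinj n)
  · intro a b hab
    rw [Function.onFun, Set.disjoint_left]
    rintro _ ⟨y, hy, rfl⟩ ⟨z, hz, h⟩
    have h' : (b : ℝ) + 1 + z = a + 1 + y := inv_injective h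
    obtain ⟨-, hy0, hy1⟩ := hy
    obtain ⟨-, hz0, hz1⟩ := hz
    refine hab (le_antisymm ?_ ?_) <;>
    · rw [← Nat.lt_add_one_iff]
      rify
      linarith

lemma hasSum_gaussMeasure_cylinder {m : ℕ} (A : Set (List ℕ)) (hA : ∀ D ∈ A, D.length = m)
    {s : Set ℝ} (hs : ∀ x, Irrational x → x ∈ Set.Ioo (0 : ℝ) 1 →
      (x ∈ s ↔ (List.range m).map (cfDigit x) ∈ A)) :
    HasSum (fun D : A => (gaussMeasure (cylinder D)).toReal) (gaussMeasure s).toReal := by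
  have h : gaussMeasure s = ∑' D : A, gaussMeasure (cylinder D) := by
    rw [← measure_iUnion _ fun D => measurableSet_cylinder _]
    · refine measure_congr (eventuallyEq_set.2 ?_)
      filter_upwards [ae_gaussMeasure] with x ⟨hx, hx'⟩
      rw [hs x hx hx', Set.mem_iUnion]
      refine ⟨fun h => ⟨⟨_, h⟩, mem_cylinder_map_cfDigit hx' m⟩, fun ⟨D, hD⟩ => ?_⟩
      rw [← eq_of_mem_cylinder (by simp [hA D D.2]) hD (mem_cylinder_map_cfDigit hx' m)]
      exact D.2
    · intro D E hDE
      refine Set.disjoint_left.2 fun x hD hE => hDE (Subtype.ext ?_)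
      exact eq_of_mem_cylinder ((hA D D.2).trans (hA E E.2).symm) hD hE
  rw [h, ENNReal.tsum_toReal_eq fun D => measure_ne_top _ _]
  exact (ENNReal.summable_toReal (h ▸ measure_ne_top _ _)).hasSum

lemma sum_blockCount_le (x : ℝ) (m N : ℕ) (F : Finset (List ℕ)) {l : ℕ}
    (hF : ∀ D ∈ F, D.length = l) : ∑ D ∈ F, blockCount x m D N ≤ N + 1 := by
  classical
  have e : ∀ D, blockCount x m D N =
      ((Finset.range (N + 1)).filter fun i => gaussMap^[m * i] x ∈ cylinder D).card := by
    intro D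
    rw [blockCount]
    refine Nat.subtype_card _ fun i => ?_
    simp
  simp_rw [e]
  rw [← Finset.card_biUnion]
  · refine (Finset.card_le_card (Finset.biUnion_subset.2 fun D _ => Finset.filter_subset _ _)).trans
      (Finset.card_range _).le
  · intro D hD E hE hDE
    rw [Function.onFun, Finset.disjoint_left]
    intro i hi hj
    exact hDE (eq_of_mem_cylinder ((hF D hD).trans (hF E hE).symm)
      (Finset.mem_filter.1 hi).2 (Finset.mem_filter.1 hj).2)

theorem limit_lemma (x : ℝ) (hx : x ∈ Set.Ioo (0:ℝ) 1)
    (hdisj : ∀ s : List ℕ, s ≠ [] → (∀ a ∈ s, 0 < a) →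
      Tendsto (fun n : ℕ => (blockCount x s.length s (n / s.length) : ℝ) /
          ((n : ℝ) / s.length)) atTop (nhds (gaussMeasure (cylinder s)).toReal))
    (s' : List ℕ) (hs' : s' ≠ []) (hpos : ∀ a ∈ s', 0 < a)
    (p q : ℕ) (hp : 1 ≤ p) (hq : 1 ≤ q) :
    Tendsto (fun n : ℕ =>
        ∑' D : {D : List ℕ // D.length = p + q + s'.length ∧ (∀ a ∈ D, 0 < a) ∧
            ∀ i < s'.length, D.getD (p + i) 0 = s'.getD i 0},
          (blockCount x (p + q + s'.length) D.1 (n / (p + q + s'.length)) : ℝ) /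
            ((n : ℝ) / (p + q + s'.length)))
      atTop (nhds (gaussMeasure (cylinder s')).toReal) := by
  classical
  obtain ⟨m, hm⟩ : ∃ m, m = p + q + s'.length := ⟨_, rfl⟩
  have hmR : (p : ℝ) + q + s'.length = m := by rw [hm]; push_cast; ring
  have hm0 : 0 < m := by omega
  simp_rw [hmR, ← hm]
  set B : Set (List ℕ) := {D | D.length = m ∧ ∀ a ∈ D, 0 < a}
  set A : Set (List ℕ) := {D | D.length = p + q + s'.length ∧ (∀ a ∈ D, 0 < a) ∧
    ∀ i < s'.length, D.getD (p + i) 0 = s'.getD i 0}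
  have hAB : ∀ D ∈ A, D ∈ B := fun D hD => ⟨hD.1.trans hm.symm, hD.2.1⟩
  have hmap : ∀ y : ℝ, Irrational y → y ∈ Set.Ioo (0 : ℝ) 1 →
      (List.range m).map (cfDigit y) ∈ B := by
    intro y hy hy'
    refine ⟨by simp, fun a ha => ?_⟩
    obtain ⟨i, -, rfl⟩ := List.mem_map.1 ha
    exact cfDigit_pos hy hy' i
  have hB : HasSum (fun D : B => (gaussMeasure (cylinder D)).toReal) 1 := by
    have := hasSum_gaussMeasure_cylinder (m := m) B (fun D hD => hD.1) (s := Set.univ)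
      fun y hy hy' => by simpa using hmap y hy hy'
    simpa using this
  have hA : HasSum (fun D : A => (gaussMeasure (cylinder D)).toReal)
      (gaussMeasure (cylinder s')).toReal := by
    rw [← (measurePreserving_gaussMap.iterate p).measure_preimage
      (measurableSet_cylinder s').nullMeasurableSet]
    refine hasSum_gaussMeasure_cylinder (m := m) A (fun D hD => (hAB D hD).1) fun y hy hy' => ?_
    have hd : ∀ i < s'.length,
        ((List.range m).map (cfDigit y)).getD (p + i) 0 = cfDigit y (p + i) := by
      intro i hi
      rw [List.getD_eq_getElem _ _ (by simp; omega)]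
      simp
    obtain ⟨h1, h2⟩ := hmap y hy hy'
    constructor
    · intro h
      refine ⟨h1.trans hm, h2, fun i hi => ?_⟩
      rw [hd i hi, ← cfDigit_iterate, h.2 i hi]
    · intro h
      refine ⟨(iterate_gaussMap_mem hy hy' p).2, fun i hi => ?_⟩
      rw [cfDigit_iterate, ← hd i hi, h.2.2 i hi]
  have main := tendsto_tsum_subtype_of_mass_le (· ∈ A)
    (fun n => B.indicator fun D => (blockCount x m D (n / m) : ℝ) / ((n : ℝ) / m))
    (B.indicator fun D => (gaussMeasure (cylinder D)).toReal) (fun n => 1 + (m : ℝ) / n)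
    (fun n D => Set.indicator_nonneg (fun D _ => by positivity) D) ?_
    (by simpa using (tendsto_const_div_atTop_nhds_zero_nat (m : ℝ)).const_add 1) ?_
    (hasSum_subtype_iff_indicator.1 hB)
  · have hi : ∀ u : List ℕ → ℝ, ∑' D : {D // D ∈ A}, B.indicator u D = ∑' D : A, u D :=
      fun u => tsum_congr fun D => Set.indicator_of_mem (hAB D D.2) u
    simp only [hi] at main
    rw [hA.tsum_eq] at main
    exact main
  · intro n F
    rw [Finset.sum_indicator_eq_sum_filter, ← Finset.sum_div, ← Nat.cast_sum]
    rcases Nat.eq_zero_or_pos n with rfl | hn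
    · simp
    have hle := sum_blockCount_le x m (n / m) (F.filter fun D => D ∈ B) (l := m)
      fun D hD => (Finset.mem_filter.1 hD).2.1
    have hn' : (0 : ℝ) < n := by exact_mod_cast hn
    have hm' : (0 : ℝ) < m := by exact_mod_cast hm0
    rw [div_le_iff₀ (by positivity)]
    calc _ ≤ ((n / m + 1 : ℕ) : ℝ) := by exact_mod_cast hle
      _ ≤ (n : ℝ) / m + 1 := by push_cast; gcongr; exact Nat.cast_div_le
      _ = _ := by field_simp
  · intro D
    by_cases hD : D ∈ B
    · simp only [Set.indicator_of_mem hD]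
      have h := hdisj D (by rintro rfl; exact hm0.ne hD.1) hD.2
      rwa [hD.1] at h
    · simp only [Set.indicator_of_notMem hD]
      exact tendsto_const_nhds
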